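/- arXiv:2208.14539 — 4 statements merged into one kernel-verified Lean document; each statement's English description precedes it below -/
import Mathlib

section
/- Let φ : [0,∞) → [0,∞) be a decreasing continuous function, and suppose there exist constants μ > 0, B₀ > 0 and s₀ ≥ 0 such that for every r > 0 and every s ≥ s₀ one has r·φ(s + r) ≤ B₀·φ(s)^{1+μ}. Then φ(s) = 0 for every s ≥ s₀ + 2B₀φ(s₀)^μ/(1 − 2^{−μ}). -/
/-- De Giorgi's lemma (Lemma 3.4): if `φ : [0,∞) → [0,∞)` is decreasing and continuous
and satisfies `r · φ(s+r) ≤ B₀ · φ(s)^{1+μ}` for all `r > 0`, `s ≥ s₀`, then `φ`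
vanishes identically on `[s₀ + 2B₀φ(s₀)^μ/(1 − 2^{−μ}), ∞)`. -/
theorem deGiorgi_lemma (φ : ℝ → ℝ)
    (hφ_nonneg : ∀ s, 0 ≤ s → 0 ≤ φ s)
    (hφ_dec : ∀ s t, 0 ≤ s → s ≤ t → φ t ≤ φ s)
    (hφ_cont : ContinuousOn φ (Set.Ici (0 : ℝ)))
    (μ B₀ s₀ : ℝ) (hμ : 0 < μ) (hB₀ : 0 < B₀) (hs₀ : 0 ≤ s₀)
    (h : ∀ r s : ℝ, 0 < r → s₀ ≤ s → r * φ (s + r) ≤ B₀ * φ s ^ (1 + μ)) :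
    ∀ s : ℝ, s₀ + 2 * B₀ * φ s₀ ^ μ / (1 - (2 : ℝ) ^ (-μ)) ≤ s → φ s = 0 := by
  intro s hs
  rcases (hφ_nonneg s₀ hs₀).eq_or_lt with ha | ha
  · rw [← ha, Real.zero_rpow hμ.ne', mul_zero, zero_div, add_zero] at hs
    exact le_antisymm (ha ▸ hφ_dec s₀ s hs₀ hs) (hφ_nonneg s (hs₀.trans hs))
  set a := φ s₀ with ha_def
  have hq_eq : (2 : ℝ) ^ (-μ) = (1 / 2 : ℝ) ^ μ := by
    rw [Real.rpow_neg zero_le_two, one_div, Real.inv_rpow zero_le_two]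
  rw [hq_eq] at hs
  set q := (1 / 2 : ℝ) ^ μ with hq
  have hq0 : 0 < q := by positivity
  have hq1 : 0 < 1 - q :=
    sub_pos.2 (Real.rpow_lt_one (by norm_num) (by norm_num) hμ)
  set D := 2 * B₀ * a ^ μ with hD
  have hD0 : 0 < D := by positivity
  have hle (n : ℕ) : s₀ ≤ s₀ + D * (1 - q ^ n) / (1 - q) := by
    have : q ^ n ≤ 1 := pow_le_one₀ hq0.le (by linarith)
    have := div_nonneg (mul_nonneg hD0.le (sub_nonneg.2 this)) hq1.le
    linarith
  have key (n : ℕ) : φ (s₀ + D * (1 - q ^ n) / (1 - q)) ≤ a * (1 / 2) ^ n := by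
    induction n with
    | zero => simp [ha_def]
    | succ n ih =>
      have hr : 0 < D * q ^ n := by positivity
      have h₁ := h _ _ hr (hle n)
      have hstep : s₀ + D * (1 - q ^ n) / (1 - q) + D * q ^ n
          = s₀ + D * (1 - q ^ (n + 1)) / (1 - q) := by
        field_simp
        ring
      rw [hstep] at h₁
      have hpow : (a * (1 / 2 : ℝ) ^ n) ^ (1 + μ) = a * (1 / 2) ^ n * (a ^ μ * q ^ n) := by
        rw [Real.rpow_add (by positivity), Real.rpow_one,
          Real.mul_rpow ha.le (by positivity), hq, Real.rpow_pow_comm (by norm_num)]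
      have h₂ := Real.rpow_le_rpow (hφ_nonneg _ (hs₀.trans (hle n))) ih
        (by positivity : 0 ≤ 1 + μ)
      rw [hpow] at h₂
      refine le_of_mul_le_mul_left ?_ hr
      calc _ ≤ _ := h₁
        _ ≤ B₀ * (a * (1 / 2) ^ n * (a ^ μ * q ^ n)) := by gcongr
        _ = D * q ^ n * (a * (1 / 2) ^ (n + 1)) := by rw [hD]; ring
  have hs_le (n : ℕ) : s₀ + D * (1 - q ^ n) / (1 - q) ≤ s := by
    refine le_trans ?_ hs
    gcongr
    exact mul_le_of_le_one_right hD0.le (by linarith [pow_pos hq0 n])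
  have hlim : Filter.Tendsto (fun n : ℕ => a * (1 / 2 : ℝ) ^ n) Filter.atTop (nhds 0) := by
    simpa using (tendsto_pow_atTop_nhds_zero_of_lt_one (r := (1 / 2 : ℝ))
      (by norm_num) (by norm_num)).const_mul a
  refine le_antisymm (ge_of_tendsto' hlim fun n => ?_)
    (hφ_nonneg s (hs₀.trans ((hle 0).trans (hs_le 0))))
  exact (hφ_dec _ _ (hs₀.trans (hle n)) (hs_le n)).trans (key n)
end

section
/- Let φ : [0,∞) → [0,∞) be a decreasing function, and suppose there exist constants μ > 0, B₀ > 0 and s₀ ≥ 0 such that for every r > 0 and every s ≥ s₀ one has r·φ(s + r) ≤ B₀·φ(s)^{1+μ}. Define a sequence by s_0 = s₀ and s_{k+1} = s_k + 2B₀φ(s_k)^μ. Then for every k ≥ 0 one has φ(s_k) ≤ 2^{−k}·φ(s₀), the sequence (s_k) is nondecreasing and converges to a limit s_∞, and s_∞ − s₀ ≤ 2B₀φ(s₀)^μ/(1 − 2^{−μ}). -/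
/-- One step of length `2 * B₀ * φ t ^ μ` at least halves `φ`. -/
theorem deGiorgi_step_le_half {φ : ℝ → ℝ} {μ B₀ t : ℝ} (hμ : 0 < μ) (hB₀ : 0 < B₀)
    (ht : 0 ≤ φ t)
    (h : ∀ r : ℝ, 0 < r → r * φ (t + r) ≤ B₀ * φ t ^ (1 + μ)) :
    φ (t + 2 * B₀ * φ t ^ μ) ≤ φ t / 2 := by
  rcases ht.eq_or_lt with h0 | hpos
  · simp [← h0, Real.zero_rpow hμ.ne']
  · have hp : 0 < φ t ^ μ := Real.rpow_pos_of_pos hpos μ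
    have hr : 0 < B₀ * φ t ^ μ := mul_pos hB₀ hp
    have key := h (2 * B₀ * φ t ^ μ) (by positivity)
    rw [Real.rpow_add hpos, Real.rpow_one] at key
    refine le_of_mul_le_mul_left ?_ hr
    linarith

/-- Key estimate in the proof of the De Giorgi lemma (Lemma 3.4): for the sequence
`s_0 = s₀`, `s_{k+1} = s_k + 2B₀ φ(s_k)^μ` one has `φ(s_k) ≤ 2^{-k} φ(s₀)`, the
sequence is nondecreasing and converges to a limit `s_∞` with
`s_∞ − s₀ ≤ 2B₀ φ(s₀)^μ / (1 − 2^{−μ})`. -/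
theorem deGiorgi_sequence (φ : ℝ → ℝ)
    (hφ_nonneg : ∀ s, 0 ≤ s → 0 ≤ φ s)
    (hφ_dec : ∀ s t, 0 ≤ s → s ≤ t → φ t ≤ φ s)
    (μ B₀ s₀ : ℝ) (hμ : 0 < μ) (hB₀ : 0 < B₀) (hs₀ : 0 ≤ s₀)
    (h : ∀ r s : ℝ, 0 < r → s₀ ≤ s → r * φ (s + r) ≤ B₀ * φ s ^ (1 + μ))
    (s : ℕ → ℝ) (hs0 : s 0 = s₀)
    (hsrec : ∀ k : ℕ, s (k + 1) = s k + 2 * B₀ * φ (s k) ^ μ) :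
    (∀ k : ℕ, φ (s k) ≤ (2 : ℝ) ^ (-(k : ℤ)) * φ s₀) ∧
    Monotone s ∧
    ∃ L : ℝ, Filter.Tendsto s Filter.atTop (nhds L) ∧
      L - s₀ ≤ 2 * B₀ * φ s₀ ^ μ / (1 - (2 : ℝ) ^ (-μ)) := by
  have hmono : Monotone s ∧ ∀ k, s₀ ≤ s k := by
    have hge : ∀ k, s₀ ≤ s k ∧ s k ≤ s (k + 1) := by
      have step : ∀ k, s₀ ≤ s k → s k ≤ s (k + 1) := fun k hk => by
        have := hφ_nonneg (s k) (hs₀.trans hk)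
        rw [hsrec k]
        exact le_add_of_nonneg_right (by positivity)
      intro k
      induction k with
      | zero => exact ⟨hs0.ge, step 0 hs0.ge⟩
      | succ k ih =>
        have hk := ih.1.trans ih.2
        exact ⟨hk, step (k + 1) hk⟩
    exact ⟨monotone_nat_of_le_succ fun k => (hge k).2, fun k => (hge k).1⟩
  obtain ⟨hmono, hge⟩ := hmono
  have hnn : ∀ k, 0 ≤ φ (s k) := fun k => hφ_nonneg _ (hs₀.trans (hge k))
  have hhalf : ∀ k, φ (s (k + 1)) ≤ φ (s k) / 2 := fun k => by
    rw [hsrec k]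
    exact deGiorgi_step_le_half hμ hB₀ (hnn k) fun r hr => h r (s k) hr (hge k)
  refine ⟨fun k => ?_, hmono, ?_⟩
  · induction k with
    | zero => simp [hs0]
    | succ k ih =>
      have hpow : (2 : ℝ) ^ (-((k + 1 : ℕ) : ℤ)) = (2 : ℝ) ^ (-(k : ℤ)) / 2 := by
        rw [Nat.cast_succ, neg_add, zpow_add₀ two_ne_zero, zpow_neg_one, div_eq_mul_inv]
      rw [hpow]
      linarith [hhalf k]
  · have hq : (0 : ℝ) < 1 - 2 ^ (-μ) :=
      sub_pos.2 (Real.rpow_lt_one_of_one_lt_of_neg one_lt_two (neg_lt_zero.2 hμ))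
    have hdecay : ∀ k, φ (s (k + 1)) ^ μ ≤ φ (s k) ^ μ * 2 ^ (-μ) := fun k =>
      calc φ (s (k + 1)) ^ μ ≤ (φ (s k) / 2) ^ μ :=
            Real.rpow_le_rpow (hnn _) (hhalf k) hμ.le
        _ = φ (s k) ^ μ * 2 ^ (-μ) := by
            rw [Real.div_rpow (hnn k) zero_le_two, Real.rpow_neg zero_le_two, div_eq_mul_inv]
    -- The potential `s k + 2 * B₀ * φ (s k) ^ μ / (1 - 2 ^ (-μ))` is nonincreasing in `k`.
    have hpot : Antitone fun k => s k + 2 * B₀ * φ (s k) ^ μ / (1 - 2 ^ (-μ)) := by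
      refine antitone_nat_of_succ_le fun k => ?_
      have hle : 2 * B₀ * φ (s (k + 1)) ^ μ / (1 - 2 ^ (-μ)) ≤
          2 * B₀ * (φ (s k) ^ μ * 2 ^ (-μ)) / (1 - 2 ^ (-μ)) := by
        gcongr
        exact hdecay k
      have heq : 2 * B₀ * φ (s k) ^ μ + 2 * B₀ * (φ (s k) ^ μ * 2 ^ (-μ)) / (1 - 2 ^ (-μ)) =
          2 * B₀ * φ (s k) ^ μ / (1 - 2 ^ (-μ)) := by
        field_simp
        ring
      linarith [hsrec k]
    have hbound : ∀ k, s k ≤ s₀ + 2 * B₀ * φ s₀ ^ μ / (1 - 2 ^ (-μ)) := fun k => by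
      have hk := hpot (Nat.zero_le k)
      have hnonneg : 0 ≤ 2 * B₀ * φ (s k) ^ μ / (1 - 2 ^ (-μ)) := by
        have := hnn k
        positivity
      simp only [hs0] at hk
      linarith
    have hlim := tendsto_atTop_ciSup hmono ⟨_, Set.forall_mem_range.2 hbound⟩
    exact ⟨_, hlim, sub_le_iff_le_add'.2 (le_of_tendsto' hlim hbound)⟩
end

section
/- Let A be an n×n Hermitian matrix with complex entries and let μ₁, …, μ_n be its eigenvalues (listed with multiplicity). Then the vector of diagonal entries (A₁₁, A₂₂, …, A_nn) ∈ ℝⁿ (the diagonal entries of a Hermitian matrix are real) lies in the convex hull of the finite set {(μ_{σ(1)}, μ_{σ(2)}, …, μ_{σ(n)}) : σ a permutation of {1,…,n}} ⊆ ℝⁿ. -/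
open Matrix in
/-- The matrix of squared moduli of the entries of a unitary matrix is doubly stochastic. -/
lemma Matrix.of_normSq_mem_doublyStochastic {ι : Type*} [Fintype ι] [DecidableEq ι]
    (U : unitaryGroup ι ℂ) :
    of (fun i j => Complex.normSq ((U : Matrix ι ι ℂ) i j)) ∈ doublyStochastic ℝ ι := by
  refine mem_doublyStochastic_iff_sum.2 ⟨fun i j => Complex.normSq_nonneg _, fun i => ?_,
    fun j => ?_⟩
  · have h := congrFun₂ (mem_unitaryGroup_iff.1 U.2) i i
    simp only [mul_apply, star_apply, RCLike.star_def, Complex.mul_conj, one_apply_eq] at h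
    exact_mod_cast h
  · have h := congrFun₂ (mem_unitaryGroup_iff'.1 U.2) j j
    simp only [mul_apply, star_apply, RCLike.star_def, ← Complex.normSq_eq_conj_mul_self,
      one_apply_eq] at h
    exact_mod_cast h

open Matrix in
/-- A doubly stochastic matrix maps a vector into the convex hull of its permutations. -/
lemma Matrix.mulVec_mem_convexHull_of_mem_doublyStochastic {ι : Type*} [Fintype ι]
    [DecidableEq ι] {M : Matrix ι ι ℝ} (hM : M ∈ doublyStochastic ℝ ι) (x : ι → ℝ) :
    M *ᵥ x ∈ convexHull ℝ {v : ι → ℝ | ∃ σ : Equiv.Perm ι, v = x ∘ σ} := by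
  obtain ⟨w, hw, hw_sum, rfl⟩ := exists_eq_sum_perm_of_mem_doublyStochastic hM
  simp only [sum_mulVec, smul_mulVec]
  refine (convex_convexHull ℝ _).sum_mem (fun σ _ => hw σ) hw_sum fun σ _ => ?_
  exact subset_convexHull ℝ _ ⟨σ, permMatrix_mulVec σ⟩

open Matrix in
/-- The diagonal of a Hermitian matrix is the image of its eigenvalues under the matrix of squared
moduli of the eigenvector coordinates. -/
lemma Matrix.IsHermitian.re_diag_eq_mulVec_eigenvalues {ι : Type*} [Fintype ι] [DecidableEq ι]
    {A : Matrix ι ι ℂ} (hA : A.IsHermitian) :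
    (fun i => (A i i).re) =
      of (fun i j => Complex.normSq ((hA.eigenvectorUnitary : Matrix ι ι ℂ) i j)) *ᵥ
        hA.eigenvalues := by
  ext i
  conv_lhs => rw [hA.spectral_theorem, Unitary.conjStarAlgAut_apply, mul_apply]
  simp only [mul_diagonal, star_apply, RCLike.star_def, mulVec, dotProduct, of_apply,
    Complex.re_sum, Function.comp_apply]
  refine Finset.sum_congr rfl fun j _ => ?_
  rw [mul_right_comm, Complex.mul_conj]
  simp

/-- Horn–Schur lemma (Lemma 3.2): the vector of diagonal entries of a Hermitian
matrix lies in the convex hull of the permutations of its eigenvalue vector. -/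
theorem horn_schur (n : ℕ) (A : Matrix (Fin n) (Fin n) ℂ) (hA : A.IsHermitian) :
    (fun i : Fin n => (A i i).re) ∈
      convexHull ℝ {v : Fin n → ℝ | ∃ σ : Equiv.Perm (Fin n), v = hA.eigenvalues ∘ σ} := by
  rw [hA.re_diag_eq_mulVec_eigenvalues]
  exact Matrix.mulVec_mem_convexHull_of_mem_doublyStochastic
    (Matrix.of_normSq_mem_doublyStochastic _) _
end

section
/- Let (X,d) be a metric space, ε > 0, 0 < α ≤ 1, and let φ : X → ℝ be α-Hölder continuous with Hölder seminorm [φ]_α = sup_{x≠y} |φ(x) − φ(y)|/d(x,y)^α finite. Let x₀, y₀ ∈ X satisfy φ(y₀) + ε − d(x₀,y₀)²/ε ≥ φ(x₀) + ε (in particular this holds when y₀ attains the supremum in the sup-convolution φ_ε(x₀) = sup_{y∈X} (φ(y) + ε − d(x₀,y)²/ε)). Then d(x₀,y₀) ≤ (ε·[φ]_α)^{1/(2−α)}. -/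
/-- Lemma 2.10 (Hölder case), metric-space content: if `φ` is `α`-Hölder with
seminorm at most `H` and `φ(y₀) + ε − d(x₀,y₀)²/ε ≥ φ(x₀) + ε` (as for a maximizer
of the sup-convolution), then `d(x₀,y₀) ≤ (εH)^{1/(2−α)}`. -/
theorem supConvolution_maximizer_dist_bound_holder {X : Type*} [MetricSpace X]
    (ε α H : ℝ) (hε : 0 < ε) (hα : 0 < α) (hα1 : α ≤ 1) (hH : 0 ≤ H)
    (φ : X → ℝ) (hHolder : ∀ x y : X, |φ x - φ y| ≤ H * dist x y ^ α)
    (x₀ y₀ : X)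
    (h : φ x₀ + ε ≤ φ y₀ + ε - dist x₀ y₀ ^ 2 / ε) :
    dist x₀ y₀ ≤ (ε * H) ^ ((1 : ℝ) / (2 - α)) := by
  rcases (dist_nonneg : 0 ≤ dist x₀ y₀).eq_or_lt with hd | hd
  · rw [← hd]
    positivity
  have hφ : φ y₀ - φ x₀ ≤ H * dist x₀ y₀ ^ α := by
    have := (neg_le_abs (φ x₀ - φ y₀)).trans (hHolder x₀ y₀)
    linarith
  have hsq : dist x₀ y₀ ^ 2 ≤ ε * H * dist x₀ y₀ ^ α := by
    have hdiv : dist x₀ y₀ ^ 2 / ε ≤ H * dist x₀ y₀ ^ α := by linarith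
    rw [div_le_iff₀ hε] at hdiv
    linarith
  have hpow : dist x₀ y₀ ^ (2 - α) ≤ ε * H := by
    rw [Real.rpow_sub hd, Real.rpow_two, div_le_iff₀ (Real.rpow_pos_of_pos hd α)]
    exact hsq
  rw [one_div]
  exact (Real.le_rpow_inv_iff_of_pos hd.le (by positivity) (by linarith)).2 hpow
end
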